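/- Let n ≥ 1 and q > 1, and let φ: ℝⁿ → (0,+∞] be an essentially continuous convex function with ∫_{ℝⁿ} φ(x)^{−(n+q)} dx = 1 and ∫_{ℝⁿ} |∇φ(x)| φ(x)^{−(n+q)} dx < +∞ (∇φ being the Lebesgue-a.e. defined gradient on the interior of {φ < +∞}). Then (n/(n+q−1)) ∫_{ℝⁿ} φ(x)^{−(n+q−1)} dx ≥ ∫_{ℝⁿ} x·∇φ(x) φ(x)^{−(n+q)} dx. -/

import Mathlib

open MeasureTheory Topology Filter Set
open scoped ENNReal RealInnerProductSpace

noncomputable section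

abbrev En (n : ℕ) : Type := EuclideanSpace ℝ (Fin n)

/-- The positive part of an extended real number, as an element of `ℝ≥0∞`. -/
def posPartNN (x : EReal) : ℝ≥0∞ := if x = ⊤ then ⊤ else ENNReal.ofReal x.toReal

/-- The integral of an `EReal`-valued function, with values in `EReal`
(defined as the integral of the positive part minus that of the negative part). -/
def eInt {X : Type*} [MeasurableSpace X] (ρ : Measure X) (g : X → EReal) : EReal :=
  ((∫⁻ x, posPartNN (g x) ∂ρ : ℝ≥0∞) : EReal) - ((∫⁻ x, posPartNN (-(g x)) ∂ρ : ℝ≥0∞) : EReal)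

/-- Transport plans between `ρ` and `μ`. -/
def Plans {n : ℕ} (ρ μ : Measure (En n)) : Set (Measure (En n × En n)) :=
  {γ | IsProbabilityMeasure γ ∧ γ.map Prod.fst = ρ ∧ γ.map Prod.snd = μ}

/-- The maximal correlation functional `T(ρ,μ)`. -/
def Tcorr {n : ℕ} (ρ μ : Measure (En n)) : EReal :=
  ⨆ γ ∈ Plans ρ μ, eInt γ (fun p => ((⟪p.1, p.2⟫ : ℝ) : EReal))

/-- The local functional `F(ρ) = ∫ f(ρ^ac) dx` with `f(t) = -t^α/α`, `α = 1 - 1/(n+q)`. -/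
def Ffun (n : ℕ) (q : ℝ) (ρ : Measure (En n)) : EReal :=
  - ((∫⁻ x, ENNReal.ofReal
      ((ρ.rnDeriv volume x).toReal ^ (1 - 1/((n : ℝ) + q)) / (1 - 1/((n : ℝ) + q)))
      ∂volume : ℝ≥0∞) : EReal)

/-- The functional `J(ρ) = F(ρ) + T(ρ,μ)`. -/
def Jfun (n : ℕ) (q : ℝ) (μ ρ : Measure (En n)) : EReal := Ffun n q ρ + Tcorr ρ μ

/-- Finite first moment. -/
def P1 {n : ℕ} (ρ : Measure (En n)) : Prop := Integrable (fun x : En n => ‖x‖) ρ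

/-- `μ` is not supported on any affine hyperplane. -/
def NotHyperplane {n : ℕ} (μ : Measure (En n)) : Prop :=
  ∀ (e : En n) (ℓ : ℝ), e ≠ 0 → μ {x | ⟪x, e⟫ = ℓ} ≠ 1


/-- A convex, lower semicontinuous function with values in `ℝ ∪ {+∞}`,
convexity being expressed through the epigraph. -/
def ConvexLSC {n : ℕ} (u : En n → EReal) : Prop :=
  LowerSemicontinuous u ∧ Convex ℝ {p : En n × ℝ | u p.1 ≤ (p.2 : EReal)}

/-- `φ` is essentially continuous: its set of discontinuity points (as a map to
`(0,+∞]`) is `H^{n-1}`-negligible. -/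
def EssCont {n : ℕ} (φ : En n → EReal) : Prop :=
  Measure.hausdorffMeasure ((n : ℝ) - 1) {x : En n | ¬ ContinuousAt φ x} = 0

/-- A sublevel set of a convex function on a real interval, if compact, carries no net mass of
the derivative of a negative power of the function. -/
lemma setIntegral_sublevel_rpow_mul_deriv_eq_zero {u G : ℝ → ℝ} {S : Set ℝ} {s c : ℝ}
    (hs : 1 < s) (hSo : IsOpen S) (hu : ConvexOn ℝ S u) (hpos : ∀ t ∈ S, 0 < u t)
    (hcpt : IsCompact {t | t ∈ S ∧ u t ≤ c})
    (hG : ∀ᵐ t, t ∈ S → HasDerivAt u (G t) t)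
    (hint : IntegrableOn (fun t => u t ^ (-s) * G t) S) :
    ∫ t in {t | t ∈ S ∧ u t ≤ c}, u t ^ (-s) * G t = 0 := by
  set K := {t | t ∈ S ∧ u t ≤ c}
  rcases K.eq_empty_or_nonempty with hKe | hKne
  · simp [hKe]
  have hKconv : Convex ℝ K := hu.convex_le c
  have hKS : K ⊆ S := fun t ht => ht.1
  have hKconn : IsConnected K := ⟨hKne, hKconv.isPreconnected⟩
  have hKIcc : K = Icc (sInf K) (sSup K) := eq_Icc_of_connected_compact hKconn hcpt
  set a := sInf K
  set b := sSup K
  have ha : a ∈ K := hcpt.sInf_mem hKne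
  have hb : b ∈ K := hcpt.sSup_mem hKne
  have hab : a ≤ b := by
    rw [hKIcc] at ha
    exact ha.2
  have hcont : ContinuousOn u S := hu.continuousOn hSo
  have hend : ∀ e ∈ K, (∀ V ∈ 𝓝 e, ∃ y ∈ V, y ∉ K) → u e = c := by
    intro e he hV
    refine le_antisymm he.2 (le_of_not_gt fun hlt => ?_)
    have h1 : ∀ᶠ y in 𝓝 e, u y < c :=
      (hcont.continuousAt (hSo.mem_nhds he.1)).eventually_lt_const hlt
    obtain ⟨y, hy, hyK⟩ := hV _ (h1.and (hSo.mem_nhds he.1))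
    exact hyK ⟨hy.2, hy.1.le⟩
  have hua : u a = c := by
    refine hend a ha fun V hV => ?_
    obtain ⟨y, hyV, hya⟩ : (V ∩ Iio a).Nonempty := Filter.nonempty_of_mem (f := 𝓝[Iio a] a)
      (inter_mem (mem_nhdsWithin_of_mem_nhds hV) self_mem_nhdsWithin)
    refine ⟨y, hyV, fun hyK => ?_⟩
    rw [hKIcc] at hyK
    exact absurd hyK.1 (not_le.2 hya)
  have hub : u b = c := by
    refine hend b hb fun V hV => ?_
    obtain ⟨y, hyV, hya⟩ : (V ∩ Ioi b).Nonempty := Filter.nonempty_of_mem (f := 𝓝[Ioi b] b)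
      (inter_mem (mem_nhdsWithin_of_mem_nhds hV) self_mem_nhdsWithin)
    refine ⟨y, hyV, fun hyK => ?_⟩
    rw [hKIcc] at hyK
    exact absurd hyK.2 (not_le.2 hya)
  have hder : ∀ t ∈ S, HasDerivWithinAt u (derivWithin u (Ioi t) t) (Ioi t) t := fun t ht =>
    hu.hasDerivWithinAt_rightDeriv_of_mem_interior (by rwa [hSo.interior_eq])
  have hae : ∀ᵐ t, t ∈ K → u t ^ (-s) * G t = u t ^ (-s) * derivWithin u (Ioi t) t := by
    filter_upwards [hG] with t ht htK
    rw [((ht (hKS htK)).hasDerivWithinAt (s := Ioi t)).derivWithin (uniqueDiffWithinAt_Ioi t)]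
  have hmeas : MeasurableSet K := hcpt.measurableSet
  have hintK : IntegrableOn (fun t => u t ^ (-s) * derivWithin u (Ioi t) t) K :=
    (hint.mono_set hKS).congr_fun_ae ((ae_restrict_iff' hmeas).2 hae)
  rw [setIntegral_congr_ae hmeas hae]
  have hftc := intervalIntegral.integral_eq_sub_of_hasDeriv_right_of_le hab
    (f := fun t => u t ^ (1 - s))
    (f' := fun t => (1 - s) * (u t ^ (-s) * derivWithin u (Ioi t) t)) ?_ ?_ ?_
  · rw [intervalIntegral.integral_const_mul, hua, hub, sub_self,
      intervalIntegral.integral_of_le hab, ← integral_Icc_eq_integral_Ioc, ← hKIcc] at hftc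
    exact (mul_eq_zero.1 hftc).resolve_left (by linarith)
  · rw [← hKIcc]
    exact (hcont.mono hKS).rpow_const fun t ht => Or.inl (hpos t (hKS ht)).ne'
  · intro t ht
    have htK : t ∈ K := by rw [hKIcc]; exact Ioo_subset_Icc_self ht
    refine ((hder t (hKS htK)).rpow_const (p := 1 - s)
      (Or.inl (hpos t (hKS htK)).ne')).congr_deriv ?_
    rw [show 1 - s - 1 = -s by ring]
    ring
  · rw [intervalIntegrable_iff_integrableOn_Icc_of_le hab, ← hKIcc]
    exact hintK.const_mul _

/-- The derivative of a negative power of a convex function with compact sublevel sets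
integrates to zero. -/
lemma setIntegral_rpow_mul_deriv_eq_zero {u G : ℝ → ℝ} {S : Set ℝ} {s : ℝ}
    (hs : 1 < s) (hSo : IsOpen S) (hu : ConvexOn ℝ S u) (hpos : ∀ t ∈ S, 0 < u t)
    (hcl : ∀ c, IsClosed {t | t ∈ S ∧ u t ≤ c})
    (hw : IntegrableOn (fun t => u t ^ (-s)) S)
    (hG : ∀ᵐ t, t ∈ S → HasDerivAt u (G t) t)
    (hint : IntegrableOn (fun t => u t ^ (-s) * G t) S) :
    ∫ t in S, u t ^ (-s) * G t = 0 := by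
  have hcpt : ∀ c, IsCompact {t | t ∈ S ∧ u t ≤ c} := by
    intro c
    refine Metric.isCompact_of_isClosed_isBounded (hcl c) ?_
    set K := {t | t ∈ S ∧ u t ≤ c}
    rcases K.eq_empty_or_nonempty with hKe | ⟨t₀, ht₀⟩
    · simp [hKe]
    have hc : 0 < c := (hpos _ ht₀.1).trans_le ht₀.2
    have hvol : volume K ≠ ⊤ := by
      have h1 := hw.measure_ge_lt_top (Real.rpow_pos_of_pos hc (-s))
      rw [Measure.restrict_apply' hSo.measurableSet] at h1
      refine ((measure_mono fun t ht => ?_).trans_lt h1).ne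
      exact ⟨Real.rpow_le_rpow_of_nonpos (hpos t ht.1) ht.2 (by linarith), ht.1⟩
    have hord : K.OrdConnected := (hu.convex_le c).ordConnected
    have hle : ∀ x ∈ K, ∀ y ∈ K, y - x ≤ (volume K).toReal := by
      intro x hx y hy
      have h2 : volume (Icc x y) ≤ volume K := measure_mono (hord.out hx hy)
      rw [Real.volume_Icc] at h2
      exact (ENNReal.ofReal_le_iff_le_toReal hvol).1 h2
    refine (Metric.isBounded_Icc (t₀ - (volume K).toReal) (t₀ + (volume K).toReal)).subset ?_
    intro t ht
    constructor
    · linarith [hle t ht t₀ ht₀]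
    · linarith [hle t₀ ht₀ t ht]
  have hU : ⋃ k : ℕ, {t | t ∈ S ∧ u t ≤ k} = S := by
    ext t
    simp only [mem_iUnion, mem_ofPred_eq]
    refine ⟨fun ⟨_, h⟩ => h.1, fun h => ?_⟩
    obtain ⟨k, hk⟩ := exists_nat_ge (u t)
    exact ⟨k, h, hk⟩
  have hlim := tendsto_setIntegral_of_monotone (μ := volume)
    (f := fun t => u t ^ (-s) * G t) (s := fun k : ℕ => {t | t ∈ S ∧ u t ≤ k})
    (fun k => (hcpt k).measurableSet)
    (fun i j hij t ht => ⟨ht.1, ht.2.trans (by exact_mod_cast hij)⟩) (by rwa [hU])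
  rw [hU] at hlim
  refine tendsto_nhds_unique hlim ?_
  simp_rw [fun k : ℕ => setIntegral_sublevel_rpow_mul_deriv_eq_zero hs hSo hu hpos (hcpt k) hG hint]
  exact tendsto_const_nhds

/-- A convex extended-valued function without the value `⊥` is convex as a real function on its
effective domain. -/
lemma ConvexLSC.convexOn_toReal {n : ℕ} {φ : En n → EReal} (hφ : ConvexLSC φ)
    (hpos : ∀ x, 0 < φ x) : ConvexOn ℝ {x | φ x < ⊤} (fun x => (φ x).toReal) := by
  have hcoe : ∀ x, φ x < ⊤ → φ x = ((φ x).toReal : EReal) := fun x hx =>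
    (EReal.coe_toReal hx.ne ((EReal.bot_lt_zero.trans (hpos x)).ne')).symm
  have key : ∀ x, φ x < ⊤ → ∀ y, φ y < ⊤ → ∀ a b : ℝ, 0 ≤ a → 0 ≤ b → a + b = 1 →
      φ (a • x + b • y) ≤ ((a * (φ x).toReal + b * (φ y).toReal : ℝ) : EReal) := by
    intro x hx y hy a b ha hb hab
    exact hφ.2 (x := (x, (φ x).toReal)) (hcoe x hx).le (y := (y, (φ y).toReal)) (hcoe y hy).le
      ha hb hab
  refine ⟨fun x hx y hy a b ha hb hab => (key x hx y hy a b ha hb hab).trans_lt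
    (EReal.coe_lt_top _), fun x hx y hy a b ha hb hab => ?_⟩
  have h := key x hx y hy a b ha hb hab
  rw [hcoe _ (h.trans_lt (EReal.coe_lt_top _))] at h
  exact EReal.coe_le_coe_iff.1 h

/-- The power `φ^{-s}`, as a real function vanishing where `φ = +∞`. -/
def negPow {n : ℕ} (φ : En n → EReal) (s : ℝ) : En n → ℝ :=
  {x | φ x < ⊤}.indicator fun x => (φ x).toReal ^ (-s)

lemma negPow_of_lt {n : ℕ} {φ : En n → EReal} {s : ℝ} {x : En n} (hx : φ x < ⊤) :
    negPow φ s x = (φ x).toReal ^ (-s) := indicator_of_mem (s := {x | φ x < ⊤}) hx _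

lemma negPow_of_not_lt {n : ℕ} {φ : En n → EReal} {s : ℝ} {x : En n} (hx : ¬ φ x < ⊤) :
    negPow φ s x = 0 := indicator_of_notMem (s := {x | φ x < ⊤}) hx _

lemma toReal_pos_of_lt_top {n : ℕ} {φ : En n → EReal} (hpos : ∀ x, 0 < φ x) {x : En n}
    (hx : φ x < ⊤) : 0 < (φ x).toReal := EReal.toReal_pos (hpos x) hx.ne

lemma negPow_nonneg {n : ℕ} {φ : En n → EReal} (hpos : ∀ x, 0 < φ x) (s : ℝ) (x : En n) :
    0 ≤ negPow φ s x :=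
  indicator_nonneg (fun _ hx => (Real.rpow_pos_of_pos (toReal_pos_of_lt_top hpos hx) _).le) x

lemma measurable_negPow {n : ℕ} {φ : En n → EReal} (hφ : ConvexLSC φ) (s : ℝ) :
    Measurable (negPow φ s) := by
  have hm : Measurable φ := hφ.1.measurable
  exact (hm.ereal_toReal.pow_const _).indicator
    (measurableSet_lt hm measurable_const)

lemma posPartNN_rpow_neg {n : ℕ} {φ : En n → EReal} (hpos : ∀ x, 0 < φ x) {s : ℝ} (hs : 0 < s)
    (x : En n) : posPartNN (φ x) ^ (-s) = ENNReal.ofReal (negPow φ s x) := by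
  by_cases hx : φ x < ⊤
  · rw [negPow_of_lt hx, posPartNN, if_neg hx.ne,
      ENNReal.ofReal_rpow_of_pos (toReal_pos_of_lt_top hpos hx)]
  · rw [negPow_of_not_lt hx, posPartNN, if_pos (not_lt_top_iff.1 hx),
      ENNReal.top_rpow_of_neg (by linarith), ENNReal.ofReal_zero]

/-- Deleting one coordinate does not increase Hausdorff measure, so an `H^m`-null subset of
`ℝ^(m+1)` projects to a Lebesgue-null subset of `ℝ^m`. -/
lemma volume_image_removeNth_eq_zero {m : ℕ} (i : Fin (m + 1)) {N : Set (En (m + 1))}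
    (hN : Measure.hausdorffMeasure (m : ℝ) N = 0) :
    volume ((fun (x : En (m + 1)) (j : Fin m) => x (i.succAbove j)) '' N) = 0 := by
  have hL : LipschitzWith 1 (fun (x : En (m + 1)) (j : Fin m) => x (i.succAbove j)) := by
    refine LipschitzWith.of_dist_le_mul fun x y => ?_
    rw [NNReal.coe_one, one_mul, dist_pi_le_iff dist_nonneg]
    intro j
    rw [dist_eq_norm, dist_eq_norm]
    exact PiLp.norm_apply_le (x - y) _
  have h := hL.hausdorffMeasure_image_le (d := (m : ℝ)) (by positivity) N
  rw [hN, mul_zero] at h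
  have hv := hausdorffMeasure_pi_real (ι := Fin m)
  rw [Fintype.card_fin] at hv
  rw [← hv]
  exact le_antisymm h bot_le

/-- Splitting off the `i`-th coordinate of `ℝ^(m+1)`. -/
def splitCoord {m : ℕ} (i : Fin (m + 1)) : En (m + 1) ≃ᵐ (Fin m → ℝ) × ℝ :=
  ((MeasurableEquiv.toLp 2 (Fin (m + 1) → ℝ)).symm.trans
    (MeasurableEquiv.piFinSuccAbove (fun _ => ℝ) i)).trans MeasurableEquiv.prodComm

lemma measurePreserving_splitCoord {m : ℕ} (i : Fin (m + 1)) :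
    MeasurePreserving (splitCoord i) :=
  (Measure.measurePreserving_swap (μ := (volume : Measure ℝ))
      (ν := (volume : Measure (Fin m → ℝ)))).comp
    ((volume_preserving_piFinSuccAbove (fun _ => ℝ) i).comp
      (EuclideanSpace.volume_preserving_symm_measurableEquiv_toLp (Fin (m + 1))))

lemma splitCoord_symm_apply {m : ℕ} (i : Fin (m + 1)) (y : Fin m → ℝ) (t : ℝ) :
    (splitCoord i).symm (y, t) = AffineMap.lineMap (k := ℝ) ((splitCoord i).symm (y, 0))
      ((splitCoord i).symm (y, 0) + EuclideanSpace.single i 1) t := by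
  have h : ∀ r, (splitCoord i).symm (y, r) = WithLp.toLp 2 (i.insertNth r y) := fun r => rfl
  rw [h, h, AffineMap.lineMap_apply]
  ext j
  refine Fin.succAboveCases i ?_ (fun k => ?_) j
  · simp
  · simp [Fin.succAbove_ne]

lemma splitCoord_symm_succAbove {m : ℕ} (i : Fin (m + 1)) (y : Fin m → ℝ) (t : ℝ) :
    (fun j => (splitCoord i).symm (y, t) (i.succAbove j)) = y := by
  have h : (splitCoord i).symm (y, t) = WithLp.toLp 2 (i.insertNth t y) := rfl
  rw [h]
  ext j
  simp

/-- For an essentially continuous convex function the gradient of a negative power has zero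
mean, coordinate by coordinate. -/
lemma integral_negPow_mul_gradient_coord_eq_zero {m : ℕ} {φ : En (m + 1) → EReal} {s : ℝ}
    (hs : 1 < s) (hpos : ∀ x, 0 < φ x) (hφ : ConvexLSC φ) (hφec : EssCont φ)
    (hw : Integrable (negPow φ s)) {g : En (m + 1) → En (m + 1)}
    (hg : ∀ᵐ x, φ x < ⊤ → HasGradientAt (fun y => (φ y).toReal) (g x) x) (i : Fin (m + 1))
    (hint : Integrable (fun x => negPow φ s x * g x i)) :
    ∫ x, negPow φ s x * g x i = 0 := by
  have hmp := (measurePreserving_splitCoord i).symm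
  have hemb := (splitCoord i).symm.measurableEmbedding
  have hN : volume ((fun (x : En (m + 1)) (j : Fin m) => x (i.succAbove j)) ''
      {x | ¬ ContinuousAt φ x}) = 0 := by
    refine volume_image_removeNth_eq_zero i ?_
    have hm : (m : ℝ) = ((m + 1 : ℕ) : ℝ) - 1 := by
      push_cast
      ring
    rw [hm]
    exact hφec
  have hint' := (hmp.integrable_comp_emb hemb).2 hint
  have hw' := (hmp.integrable_comp_emb hemb).2 hw
  have hg' := hmp.quasiMeasurePreserving.ae hg
  rw [← hmp.integral_comp hemb]
  change Integrable _ (Measure.prod volume volume) at hint' hw'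
  change ∀ᵐ z ∂(Measure.prod volume volume), _ at hg'
  change ∫ z, _ ∂(Measure.prod volume volume) = 0
  refine (integral_prod _ hint').trans (integral_eq_zero_of_ae ?_)
  filter_upwards [hint'.prod_right_ae, hw'.prod_right_ae, Measure.ae_ae_of_ae_prod hg',
    measure_eq_zero_iff_ae_notMem.1 hN] with y hyint hyw hyg hyN
  set p := (splitCoord i).symm (y, 0)
  set γ : ℝ →ᵃ[ℝ] En (m + 1) := AffineMap.lineMap p (p + EuclideanSpace.single i 1)
  have hγe : ∀ t, (splitCoord i).symm (y, t) = γ t := splitCoord_symm_apply i y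
  have hγc : Continuous γ := AffineMap.lineMap_continuous
  have hγd : ∀ t, HasDerivAt γ (EuclideanSpace.single i 1) t := fun t =>
    AffineMap.hasDerivAt_lineMap.congr_deriv (add_sub_cancel_left _ _)
  have hcts : ∀ t, ContinuousAt φ (γ t) := by
    intro t
    by_contra hcon
    exact hyN ⟨γ t, hcon, by rw [← hγe]; exact splitCoord_symm_succAbove i y t⟩
  simp only [Function.comp_apply, hγe] at hyint hyw hyg
  simp only [Function.comp_apply, hγe, Pi.zero_apply]
  set S : Set ℝ := {t | φ (γ t) < ⊤}
  have hSo : IsOpen S := isOpen_iff_mem_nhds.2 fun t ht =>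
    hγc.continuousAt.eventually ((hcts t).eventually_lt_const ht)
  have hind : ∀ t, negPow φ s (γ t) = S.indicator (fun t => (φ (γ t)).toReal ^ (-s)) t :=
    fun t => rfl
  have hind2 : ∀ t, negPow φ s (γ t) * g (γ t) i
      = S.indicator (fun t => (φ (γ t)).toReal ^ (-s) * g (γ t) i) t := fun t => by
    rw [hind, indicator_mul_left]
  simp_rw [hind2] at hyint ⊢
  simp_rw [hind] at hyw
  rw [integral_indicator hSo.measurableSet]
  rw [integrable_indicator_iff hSo.measurableSet] at hyint hyw
  refine setIntegral_rpow_mul_deriv_eq_zero (u := fun t => (φ (γ t)).toReal) hs hSo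
    ((hφ.convexOn_toReal hpos).comp_affineMap γ) (fun t ht => toReal_pos_of_lt_top hpos ht) ?_
    hyw ?_ hyint
  · intro c
    have hset : {t | t ∈ S ∧ (φ (γ t)).toReal ≤ c} = γ ⁻¹' (φ ⁻¹' Iic (c : EReal)) := by
      ext t
      simp only [mem_ofPred_eq, mem_preimage, mem_Iic]
      constructor
      · rintro ⟨h1, h2⟩
        rw [← EReal.coe_toReal h1.ne ((EReal.bot_lt_zero.trans (hpos _)).ne')]
        exact_mod_cast h2
      · intro h
        have h1 : φ (γ t) < ⊤ := h.trans_lt (EReal.coe_lt_top c)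
        refine ⟨h1, ?_⟩
        rw [← EReal.coe_toReal h1.ne ((EReal.bot_lt_zero.trans (hpos _)).ne')] at h
        exact_mod_cast h
    rw [hset]
    exact (hφ.1.isClosed_preimage _).preimage hγc
  · filter_upwards [hyg] with t ht htS
    have h := (ht htS).hasFDerivAt.comp_hasDerivAt t (hγd t)
    refine h.congr_deriv ?_
    simp [InnerProductSpace.toDual_apply_apply, EuclideanSpace.inner_single_right]

/-- The tangent-line inequality for the convex function `z ↦ z^{-p}`. -/
lemma rpow_neg_tangent_le {a b p : ℝ} (ha : 0 < a) (hb : 0 < b) (hp : 0 ≤ p) :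
    a ^ (-p) - p * a ^ (-(p + 1)) * (b - a) ≤ b ^ (-p) := by
  have hr : 0 < b / a := div_pos hb ha
  have h1 : 1 - p * (b / a - 1) ≤ (b / a) ^ (-p) := by
    rw [Real.rpow_def_of_pos hr]
    have h2 := Real.add_one_le_exp (Real.log (b / a) * -p)
    have h3 := mul_le_mul_of_nonneg_left (Real.log_le_sub_one_of_pos hr) hp
    linarith
  have h4 := mul_le_mul_of_nonneg_left h1 (Real.rpow_pos_of_pos ha (-p)).le
  rw [← Real.mul_rpow ha.le hr.le, mul_div_cancel₀ _ ha.ne'] at h4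
  refine le_of_eq_of_le ?_ h4
  rw [neg_add, Real.rpow_add ha, Real.rpow_neg_one]
  field_simp

/-- Fatou's lemma for Bochner integrals of real functions. -/
lemma integrable_and_integral_le_of_tendsto {X : Type*} [MeasurableSpace X] {μ : Measure X}
    {A : ℕ → X → ℝ} {L : X → ℝ} {B : ℕ → ℝ} {l : ℝ}
    (hA0 : ∀ k, 0 ≤ᵐ[μ] A k) (hAint : ∀ k, Integrable (A k) μ)
    (hlim : ∀ᵐ x ∂μ, Tendsto (fun k => A k x) atTop (𝓝 (L x)))
    (hB : ∀ k, ∫ x, A k x ∂μ ≤ B k) (hl : Tendsto B atTop (𝓝 l)) :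
    Integrable L μ ∧ ∫ x, L x ∂μ ≤ l := by
  have hL0 : 0 ≤ᵐ[μ] L := by
    filter_upwards [hlim, ae_all_iff.2 hA0] with x hx h0
    exact ge_of_tendsto' hx h0
  have hLm : AEStronglyMeasurable L μ :=
    aestronglyMeasurable_of_tendsto_ae atTop (fun k => (hAint k).1) hlim
  have hl0 : 0 ≤ l := ge_of_tendsto' hl fun k =>
    (integral_nonneg_of_ae (hA0 k)).trans (hB k)
  have hle : ∫⁻ x, ENNReal.ofReal (L x) ∂μ ≤ ENNReal.ofReal l := by
    have h1 : ∫⁻ x, ENNReal.ofReal (L x) ∂μ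
        = ∫⁻ x, liminf (fun k => ENNReal.ofReal (A k x)) atTop ∂μ := by
      refine lintegral_congr_ae ?_
      filter_upwards [hlim] with x hx
      exact (ENNReal.tendsto_ofReal hx).liminf_eq.symm
    rw [h1]
    refine (lintegral_liminf_le' fun k => (hAint k).1.aemeasurable.ennreal_ofReal).trans ?_
    simp_rw [fun k => (ofReal_integral_eq_lintegral_ofReal (hAint k) (hA0 k)).symm]
    rw [← (ENNReal.tendsto_ofReal hl).liminf_eq]
    exact liminf_le_liminf (Eventually.of_forall fun k => ENNReal.ofReal_le_ofReal (hB k))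
  refine ⟨⟨hLm, (hasFiniteIntegral_iff_ofReal hL0).2 (hle.trans_lt ENNReal.ofReal_lt_top)⟩, ?_⟩
  rw [integral_eq_lintegral_of_nonneg_ae hL0 hLm]
  exact ENNReal.toReal_le_of_le_ofReal hl0 hle

/-- Integration by parts against the radial field centred at a point of the domain: the boundary
term has a sign because the domain is star-shaped. -/
lemma integral_negPow_mul_inner_sub_le {n : ℕ} {φ : En n → EReal} {s : ℝ} (hs : 1 < s)
    (hpos : ∀ x, 0 < φ x) (hφ : ConvexLSC φ) (hw : Integrable (negPow φ s))
    (hf : Integrable (negPow φ (s - 1))) {g : En n → En n}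
    (hg : ∀ᵐ x, φ x < ⊤ → HasGradientAt (fun y => (φ y).toReal) (g x) x) {x₀ : En n}
    (hx₀ : φ x₀ < ⊤) :
    Integrable (fun x => negPow φ s x * ⟪x - x₀, g x⟫) ∧
      (s - 1) * ∫ x, negPow φ s x * ⟪x - x₀, g x⟫ ≤ n * ∫ x, negPow φ (s - 1) x := by
  set c := (φ x₀).toReal with hc
  have hcpos : 0 < c := toReal_pos_of_lt_top hpos hx₀
  set f := negPow φ (s - 1) with hfdef
  set w := negPow φ s with hwdef
  have hp : 0 < s - 1 := by linarith
  obtain ⟨t, -, ht, htlim⟩ := exists_seq_strictMono_tendsto' (zero_lt_one' ℝ)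
  have htne : Tendsto t atTop (𝓝[≠] 1) :=
    tendsto_nhdsWithin_iff.2 ⟨htlim, Eventually.of_forall fun k => (ht k).2.ne⟩
  have hγ : ∀ x (r : ℝ), AffineMap.lineMap (k := ℝ) x₀ x r = r • x + (1 - r) • x₀ := fun x r => by
    rw [AffineMap.lineMap_apply_module, add_comm]
  set A : ℕ → En n → ℝ := fun k x =>
    (f (t k • x + (1 - t k) • x₀) - f x) / (1 - t k) + (s - 1) * c * w x with hA
  set L : En n → ℝ := fun x => (s - 1) * (w x * ⟪x - x₀, g x⟫) + (s - 1) * c * w x with hL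
  have hA0 : ∀ k x, 0 ≤ A k x := by
    intro k x
    have h1t : 0 < 1 - t k := by linarith [(ht k).2]
    by_cases hx : φ x < ⊤
    · have hconv := hφ.convexOn_toReal hpos
      have hxt : φ (t k • x + (1 - t k) • x₀) < ⊤ :=
        hconv.1 hx hx₀ (ht k).1.le h1t.le (by ring)
      have hle := hconv.2 hx hx₀ (ht k).1.le h1t.le (by ring)
      have hxp := toReal_pos_of_lt_top hpos hx
      have htan := rpow_neg_tangent_le hxp (toReal_pos_of_lt_top hpos hxt) hp.le
      simp only [hA, hfdef, hwdef, negPow_of_lt hx, negPow_of_lt hxt]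
      simp only [smul_eq_mul, ← hc] at hle
      rw [sub_add_cancel] at htan
      set a := (φ x).toReal
      set b := (φ (t k • x + (1 - t k) • x₀)).toReal
      have hap : 0 < a ^ (-s) := Real.rpow_pos_of_pos hxp _
      have h2 : b - a ≤ (1 - t k) * c := by nlinarith
      have h3 : (s - 1) * a ^ (-s) * (b - a) ≤ (s - 1) * a ^ (-s) * ((1 - t k) * c) :=
        mul_le_mul_of_nonneg_left h2 (by positivity)
      rw [div_add' _ _ _ h1t.ne']
      refine div_nonneg ?_ h1t.le
      linarith
    · simp only [hA, hfdef, hwdef, negPow_of_not_lt hx, sub_zero, mul_zero, add_zero]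
      exact div_nonneg (negPow_nonneg hpos _ _) h1t.le
  set D : Set (En n) := {x | φ x < ⊤}
  have hDm : MeasurableSet D := measurableSet_lt hφ.1.measurable measurable_const
  have hlim : ∀ᵐ x ∂volume.restrict D, Tendsto (fun k => A k x) atTop (𝓝 (L x)) := by
    filter_upwards [ae_restrict_of_ae hg, ae_restrict_mem hDm] with x hgx hx
    change φ x < ⊤ at hx
    refine Tendsto.add ?_ tendsto_const_nhds
    have hxp := toReal_pos_of_lt_top hpos hx
    have hder : HasDerivAt (fun r => (φ (AffineMap.lineMap (k := ℝ) x₀ x r)).toReal)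
        ⟪g x, x - x₀⟫ 1 := by
      have h : HasFDerivAt (fun y => (φ y).toReal) (InnerProductSpace.toDual ℝ (En n) (g x))
          (AffineMap.lineMap (k := ℝ) x₀ x (1 : ℝ)) := by
        rw [AffineMap.lineMap_apply_one]
        exact (hgx hx).hasFDerivAt
      exact h.comp_hasDerivAt (1 : ℝ) AffineMap.hasDerivAt_lineMap
    have hder2 := (hder.rpow_const (p := -(s - 1))
      (Or.inl (by rw [AffineMap.lineMap_apply_one]; exact hxp.ne'))).tendsto_slope.comp htne
    have hder3 := hder2.neg
    rw [AffineMap.lineMap_apply_one] at hder3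
    convert hder3 using 2 with k
    · have hxt : φ (t k • x + (1 - t k) • x₀) < ⊤ :=
        (hφ.convexOn_toReal hpos).1 hx hx₀ (ht k).1.le (by linarith [(ht k).2]) (by ring)
      rw [Function.comp_apply, slope_def_field, AffineMap.lineMap_apply_one, hγ, hfdef,
        negPow_of_lt hx, negPow_of_lt hxt, ← neg_sub (1 : ℝ) (t k), div_neg, neg_neg]
    · rw [hwdef, negPow_of_lt hx, real_inner_comm, show -(s - 1) - 1 = -s by ring]
      ring
  have hcomp : ∀ k, Integrable (fun x => f (t k • x + (1 - t k) • x₀)) := fun k =>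
    (hf.comp_add_right ((1 - t k) • x₀)).comp_smul (ht k).1.ne'
  have hcompint : ∀ k, ∫ x, f (t k • x + (1 - t k) • x₀) = (t k ^ n)⁻¹ * ∫ x, f x := by
    intro k
    have h := Measure.integral_comp_smul_of_nonneg volume
      (fun z => f (z + (1 - t k) • x₀)) (t k) (hR := (ht k).1.le)
    rw [h, integral_add_right_eq_self, finrank_euclideanSpace_fin, smul_eq_mul]
  have hAint : ∀ k, Integrable (A k) := fun k =>
    (((hcomp k).sub hf).div_const _).add (hw.const_mul _)
  have hAval : ∀ k, ∫ x, A k x = ((t k ^ n)⁻¹ - 1) / (1 - t k) * (∫ x, f x)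
      + (s - 1) * c * ∫ x, w x := by
    intro k
    have hquot : Integrable (fun x => (f (t k • x + (1 - t k) • x₀) - f x) / (1 - t k)) :=
      ((hcomp k).sub hf).div_const _
    simp only [hA]
    rw [integral_add hquot (hw.const_mul _), integral_div,
      integral_sub (hcomp k) hf, hcompint, integral_const_mul]
    ring
  have hl : Tendsto (fun k => ∫ x, A k x) atTop
      (𝓝 (n * (∫ x, f x) + (s - 1) * c * ∫ x, w x)) := by
    simp_rw [hAval]
    refine Tendsto.add_const _ (Tendsto.mul_const _ ?_)
    have hder : HasDerivAt (fun r : ℝ => (r ^ n)⁻¹) (-n) 1 := by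
      simpa using (hasDerivAt_pow n (1 : ℝ)).fun_inv (by simp)
    have h := (hder.tendsto_slope.comp htne).neg
    rw [neg_neg] at h
    refine h.congr fun k => ?_
    rw [Function.comp_apply, slope_def_field, one_pow, inv_one, ← neg_sub (1 : ℝ) (t k), div_neg,
      neg_neg]
  obtain ⟨hLint, hLle⟩ := integrable_and_integral_le_of_tendsto (μ := volume.restrict D)
    (fun k => Eventually.of_forall (hA0 k)) (fun k => (hAint k).restrict) hlim
    (fun k => setIntegral_le_integral (hAint k) (Eventually.of_forall (hA0 k))) hl
  have hL0 : ∀ x, x ∉ D → L x = 0 := fun x hx => by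
    simp only [hL, hwdef, negPow_of_not_lt hx, zero_mul, mul_zero, add_zero]
  have hLint' : Integrable L := (integrableOn_iff_integrable_of_support_subset fun x hx => by
    by_contra hxD
    exact hx (hL0 x hxD)).1 hLint
  rw [setIntegral_eq_integral_of_forall_compl_eq_zero hL0] at hLle
  have hint : Integrable (fun x => w x * ⟪x - x₀, g x⟫) := by
    refine ((hLint'.sub (hw.const_mul ((s - 1) * c))).const_mul (s - 1)⁻¹).congr
      (Eventually.of_forall fun x => ?_)
    simp only [hL, Pi.sub_apply]
    field_simp
    ring
  refine ⟨hint, ?_⟩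
  simp only [hL] at hLle
  rw [integral_add (hint.const_mul _) (hw.const_mul _), integral_const_mul,
    integral_const_mul] at hLle
  linarith

/-- On integrable real functions the extended integral is the Bochner integral. -/
lemma eInt_coe_of_integrable {X : Type*} [MeasurableSpace X] {μ : Measure X} {h : X → ℝ}
    (hh : Integrable h μ) : eInt μ (fun x => (h x : EReal)) = ((∫ x, h x ∂μ : ℝ) : EReal) := by
  have hp : ∀ r : ℝ, posPartNN (r : EReal) = ENNReal.ofReal r := fun r => by
    rw [posPartNN, if_neg (EReal.coe_ne_top r), EReal.toReal_coe]
  have h1 : ∫⁻ x, ENNReal.ofReal (h x) ∂μ ≠ ⊤ := hh.lintegral_lt_top.ne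
  have h2 : ∫⁻ x, ENNReal.ofReal (-h x) ∂μ ≠ ⊤ := hh.neg.lintegral_lt_top.ne
  rw [eInt, integral_eq_lintegral_pos_part_sub_lintegral_neg_part hh, EReal.coe_sub,
    EReal.coe_ennreal_toReal h1, EReal.coe_ennreal_toReal h2]
  simp_rw [← EReal.coe_neg, hp]

/-- The key integration-by-parts inequality:
`(n/(n+q-1)) ∫ φ^{-(n+q-1)} ≥ ∫ x·∇φ(x) φ(x)^{-(n+q)} dx`. -/
theorem qMomentMeasures_ibp_inequality
    (n : ℕ) (hn : 1 ≤ n) (q : ℝ) (hq : 1 < q)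
    (φ : En n → EReal) (hφpos : ∀ x, 0 < φ x) (hφ : ConvexLSC φ) (hφec : EssCont φ)
    (ρbar : Measure (En n))
    (hρdef : ρbar = volume.withDensity (fun x => posPartNN (φ x) ^ (-((n : ℝ) + q))))
    (hρprob : ∫⁻ x, posPartNN (φ x) ^ (-((n : ℝ) + q)) ∂volume = 1)
    (g : En n → En n) (hg_meas : AEMeasurable g ρbar)
    (hg : ∀ᵐ x ∂ρbar, HasGradientAt (fun y => (φ y).toReal) (g x) x)
    (hgint : ∫⁻ x, ENNReal.ofReal ‖g x‖ ∂ρbar ≠ ⊤) :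
    eInt ρbar (fun x => ((⟪x, g x⟫ : ℝ) : EReal)) ≤
      (((n : ℝ) / ((n : ℝ) + q - 1) : ℝ) : EReal) *
        ((∫⁻ x, posPartNN (φ x) ^ (-(((n : ℝ) + q - 1))) ∂volume : ℝ≥0∞) : EReal) := by
  have hn' : (1 : ℝ) ≤ n := by exact_mod_cast hn
  set s : ℝ := (n : ℝ) + q with hs
  have hs1 : 1 < s := by linarith
  have hp : 0 < s - 1 := by linarith
  simp_rw [posPartNN_rpow_neg hφpos hp]
  simp_rw [posPartNN_rpow_neg hφpos (zero_lt_one.trans hs1)] at hρdef hρprob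
  have hwm : Measurable fun x => ENNReal.ofReal (negPow φ s x) :=
    (measurable_negPow hφ s).ennreal_ofReal
  by_cases hfin : ∫⁻ x, ENNReal.ofReal (negPow φ (s - 1) x) = ⊤
  · rw [hfin, EReal.coe_ennreal_top, EReal.coe_mul_top_of_pos (by positivity)]
    exact le_top
  have hf : Integrable (negPow φ (s - 1)) :=
    ⟨(measurable_negPow hφ _).aestronglyMeasurable, (hasFiniteIntegral_iff_ofReal
      (Eventually.of_forall (negPow_nonneg hφpos _))).2 (lt_top_iff_ne_top.2 hfin)⟩
  have hw : Integrable (negPow φ s) :=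
    ⟨(measurable_negPow hφ _).aestronglyMeasurable, (hasFiniteIntegral_iff_ofReal
      (Eventually.of_forall (negPow_nonneg hφpos _))).2 (by simp [hρprob])⟩
  obtain ⟨x₀, hx₀⟩ : ∃ x₀, φ x₀ < ⊤ := by
    by_contra! h
    simp [negPow_of_not_lt (not_lt.2 (h _))] at hρprob
  have hg' : ∀ᵐ x, φ x < ⊤ → HasGradientAt (fun y => (φ y).toReal) (g x) x := by
    rw [hρdef, ae_withDensity_iff hwm] at hg
    filter_upwards [hg] with x hx hxt
    refine hx (ENNReal.ofReal_pos.2 ?_).ne'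
    rw [negPow_of_lt hxt]
    exact Real.rpow_pos_of_pos (toReal_pos_of_lt_top hφpos hxt) _
  have hgρ : Integrable g ρbar := by
    refine ⟨hg_meas.aestronglyMeasurable, ?_⟩
    rw [hasFiniteIntegral_iff_norm]
    exact lt_top_iff_ne_top.2 hgint
  have hiff : ∀ h : En n → ℝ, Integrable h ρbar ↔ Integrable (fun x => negPow φ s x * h x) := by
    intro h
    rw [hρdef, integrable_withDensity_iff_integrable_smul' hwm
      (Eventually.of_forall fun _ => ENNReal.ofReal_lt_top)]
    simp_rw [ENNReal.toReal_ofReal (negPow_nonneg hφpos s _), smul_eq_mul]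
  have hintρ : ∀ h : En n → ℝ, ∫ x, h x ∂ρbar = ∫ x, negPow φ s x * h x := by
    intro h
    rw [hρdef, integral_withDensity_eq_integral_toReal_smul hwm
      (Eventually.of_forall fun _ => ENNReal.ofReal_lt_top)]
    simp_rw [ENNReal.toReal_ofReal (negPow_nonneg hφpos s _), smul_eq_mul]
  have hgi : ∀ i, Integrable (fun x => g x i) ρbar := fun i =>
    (EuclideanSpace.proj (𝕜 := ℝ) i : En n →L[ℝ] ℝ).integrable_comp hgρ
  have hgi0 : ∀ i, ∫ x, g x i ∂ρbar = 0 := by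
    intro i
    rw [hintρ]
    obtain ⟨m, rfl⟩ : ∃ m, n = m + 1 := ⟨n - 1, by omega⟩
    exact integral_negPow_mul_gradient_coord_eq_zero hs1 hφpos hφ hφec hw hg' i
      ((hiff _).1 (hgi i))
  have hx₀int : Integrable (fun x => ⟪x₀, g x⟫) ρbar := hgρ.const_inner x₀
  have hx₀0 : ∫ x, ⟪x₀, g x⟫ ∂ρbar = 0 := by
    have hg0 : ∫ x, g x ∂ρbar = 0 := by
      ext i
      have h := (EuclideanSpace.proj (𝕜 := ℝ) i : En n →L[ℝ] ℝ).integral_comp_comm hgρ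
      exact h.symm.trans (hgi0 i)
    rw [integral_inner hgρ, hg0, inner_zero_right]
  obtain ⟨hint, hle⟩ := integral_negPow_mul_inner_sub_le hs1 hφpos hφ hw hf hg' hx₀
  rw [← hiff] at hint
  rw [← hintρ] at hle
  have hsplit : ∀ x, ⟪x, g x⟫ = ⟪x - x₀, g x⟫ + ⟪x₀, g x⟫ := fun x => by
    rw [← inner_add_left, sub_add_cancel]
  have hval : ∫ x, ⟪x, g x⟫ ∂ρbar = ∫ x, ⟪x - x₀, g x⟫ ∂ρbar := by
    simp_rw [hsplit]
    rw [integral_add hint hx₀int, hx₀0, add_zero]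
  have hintx : Integrable (fun x => ⟪x, g x⟫) ρbar := by
    simp_rw [hsplit]
    exact hint.add hx₀int
  rw [eInt_coe_of_integrable hintx, hval, ← ofReal_integral_eq_lintegral_ofReal hf
    (Eventually.of_forall (negPow_nonneg hφpos _)), EReal.coe_ennreal_ofReal,
    max_eq_left (integral_nonneg (negPow_nonneg hφpos _)), ← EReal.coe_mul, EReal.coe_le_coe_iff,
    div_mul_eq_mul_div, le_div_iff₀ hp]
  linarith

end
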